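/- arXiv:2109.08531 — 2 statements merged into one kernel-verified Lean document; each statement's English description precedes it below -/
import Mathlib

section
/- Let n ≥ 1 be odd, let S be the set of η-skew-symmetric endomorphisms of ℝ^{n+2} with the conjugation action of the orthochronous Lorentz group O⁺(1,n+1), and give the orbit space S/O⁺(1,n+1) the quotient topology. Let c : S → ℝ be the degree-1 coefficient of the characteristic polynomial. Then the closure in the orbit space of the image of {F ∈ S : c(F) < 0} equals the image of {F ∈ S : c(F) ≤ 0}; in particular the images of {c > 0} and {c < 0} are disjoint open sets and no orbit with c > 0 is a limit of orbits with c < 0. -/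
open Matrix

/-- The Minkowski bilinear form of signature `(1, n+1)` on `ℝ^{n+2}`. -/
noncomputable def mink (n : ℕ) (u v : Fin (n + 2) → ℝ) : ℝ :=
  -(u 0 * v 0) + ∑ k : Fin (n + 1), u k.succ * v k.succ

/-- `η`-skew-symmetric endomorphisms of `ℝ^{n+2}`. -/
def EtaSkew (n : ℕ) (F : Matrix (Fin (n + 2)) (Fin (n + 2)) ℝ) : Prop :=
  ∀ u v, mink n (F.mulVec u) v + mink n u (F.mulVec v) = 0

/-- Orthochronous Lorentz transformations of `ℝ^{n+2}`. -/
def OrthoLorentz (n : ℕ) (Λ : Matrix (Fin (n + 2)) (Fin (n + 2)) ℝ) : Prop :=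
  IsUnit Λ.det ∧ (∀ u v, mink n (Λ.mulVec u) (Λ.mulVec v) = mink n u v) ∧
    mink n (Λ.mulVec (Pi.single 0 1)) (Pi.single 0 1) < 0

/-- The conjugation relation on `η`-skew-symmetric endomorphisms induced by the action
of the orthochronous Lorentz group. -/
def conjRel (n : ℕ)
    (F F' : {F : Matrix (Fin (n + 2)) (Fin (n + 2)) ℝ // EtaSkew n F}) : Prop :=
  ∃ Λ, OrthoLorentz n Λ ∧ F'.1 = Λ * F.1 * Λ⁻¹

/-- The degree-1 coefficient of the characteristic polynomial (the relevant invariant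
for `n` odd). -/
noncomputable def cOdd (n : ℕ)
    (F : {F : Matrix (Fin (n + 2)) (Fin (n + 2)) ℝ // EtaSkew n F}) : ℝ :=
  (Matrix.charpoly F.1).coeff 1

/-- The Gram matrix of the Minkowski form. -/
noncomputable def minkGram (n : ℕ) : Matrix (Fin (n + 2)) (Fin (n + 2)) ℝ :=
  diagonal (Fin.cons (-1) fun _ => 1)

lemma mink_eq_dotProduct (n : ℕ) (u v : Fin (n + 2) → ℝ) :
    mink n u v = u ⬝ᵥ (minkGram n *ᵥ v) := by
  simp [mink, minkGram, dotProduct, mulVec_diagonal, Fin.sum_univ_succ (n := n + 1)]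

lemma minkGram_mul_self (n : ℕ) : minkGram n * minkGram n = 1 := by
  rw [minkGram, diagonal_mul_diagonal, ← diagonal_one]
  congr 1
  funext i
  refine Fin.cases ?_ (fun j => ?_) i <;> simp

lemma det_minkGram (n : ℕ) : (minkGram n).det = -1 := by
  simp [minkGram, det_diagonal, Fin.prod_univ_succ (n := n + 1)]

lemma minkGram_transpose (n : ℕ) : (minkGram n)ᵀ = minkGram n := diagonal_transpose _

lemma mink_comm (n : ℕ) (u v : Fin (n + 2) → ℝ) : mink n u v = mink n v u := by
  simp [mink, mul_comm]

lemma mink_mulVec_left (n : ℕ) (M : Matrix (Fin (n + 2)) (Fin (n + 2)) ℝ)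
    (u v : Fin (n + 2) → ℝ) : mink n (M *ᵥ u) v = u ⬝ᵥ ((Mᵀ * minkGram n) *ᵥ v) := by
  rw [mink_eq_dotProduct, ← mulVec_mulVec, dotProduct_comm, dotProduct_mulVec,
    dotProduct_comm, ← mulVec_transpose]

lemma mink_mulVec_right (n : ℕ) (M : Matrix (Fin (n + 2)) (Fin (n + 2)) ℝ)
    (u v : Fin (n + 2) → ℝ) : mink n u (M *ᵥ v) = u ⬝ᵥ ((minkGram n * M) *ᵥ v) := by
  rw [mink_eq_dotProduct, ← mulVec_mulVec]

lemma etaSkew_iff (n : ℕ) (F : Matrix (Fin (n + 2)) (Fin (n + 2)) ℝ) :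
    EtaSkew n F ↔ Fᵀ * minkGram n = -(minkGram n * F) := by
  simp only [EtaSkew, mink_mulVec_left, mink_mulVec_right, ← dotProduct_add, ← add_mulVec]
  constructor
  · intro h
    rw [← add_eq_zero_iff_eq_neg]
    ext i j
    simpa using h (Pi.single i 1) (Pi.single j 1)
  · intro h u v
    simp [h]

lemma EtaSkew.det_eq_zero {n : ℕ} (hodd : Odd n) {F : Matrix (Fin (n + 2)) (Fin (n + 2)) ℝ}
    (hF : EtaSkew n F) : F.det = 0 := by
  have h := congrArg det ((etaSkew_iff n F).1 hF)
  have ho : Odd (n + 2) := by grind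
  rw [det_mul, det_transpose, det_neg, det_mul, det_minkGram, Fintype.card_fin,
    ho.neg_one_pow] at h
  linarith

lemma EtaSkew.add {n : ℕ} {F G : Matrix (Fin (n + 2)) (Fin (n + 2)) ℝ}
    (hF : EtaSkew n F) (hG : EtaSkew n G) : EtaSkew n (F + G) := by
  rw [etaSkew_iff] at *
  rw [transpose_add, add_mul, hF, hG, mul_add, neg_add]

lemma EtaSkew.smul {n : ℕ} {F : Matrix (Fin (n + 2)) (Fin (n + 2)) ℝ}
    (hF : EtaSkew n F) (t : ℝ) : EtaSkew n (t • F) := by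
  rw [etaSkew_iff] at *
  rw [transpose_smul, Matrix.smul_mul, hF, Matrix.mul_smul, smul_neg]

lemma EtaSkew.mink_self {n : ℕ} {F : Matrix (Fin (n + 2)) (Fin (n + 2)) ℝ}
    (hF : EtaSkew n F) (x : Fin (n + 2) → ℝ) : mink n x (F *ᵥ x) = 0 := by
  have := hF x x
  rw [mink_comm n (F *ᵥ x)] at this
  linarith

lemma EtaSkew.mink_mulVec_of_mulVec_eq_zero {n : ℕ}
    {F : Matrix (Fin (n + 2)) (Fin (n + 2)) ℝ} (hF : EtaSkew n F) {v : Fin (n + 2) → ℝ}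
    (hv : F *ᵥ v = 0) (x : Fin (n + 2) → ℝ) : mink n v (F *ᵥ x) = 0 := by
  have := hF v x
  rw [hv] at this
  simpa [mink] using this

/-- A real square matrix with nonnegative quadratic form has nonnegative determinant;
symmetry is not needed. -/
lemma Matrix.det_nonneg_of_dotProduct_mulVec_nonneg {m : Type*} [Fintype m] [DecidableEq m]
    (M : Matrix m m ℝ) (hM : ∀ x, 0 ≤ x ⬝ᵥ (M *ᵥ x)) : 0 ≤ M.det := by
  by_contra! hneg
  let f : ℝ → ℝ := fun t => (t • M + (1 - t) • (1 : Matrix m m ℝ)).det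
  have hf : Continuous f := by
    refine Continuous.matrix_det ?_
    fun_prop
  obtain ⟨t, ht, h0⟩ := intermediate_value_Icc' zero_le_one hf.continuousOn
    (show (0 : ℝ) ∈ Set.Icc (f 1) (f 0) by simp [f, hneg.le])
  have ht1 : t ≠ 1 := by
    rintro rfl
    simp [f] at h0
    exact hneg.ne h0
  obtain ⟨x, hx, hx0⟩ := exists_mulVec_eq_zero_iff.2 h0
  have h := congrArg (fun y => x ⬝ᵥ y) hx0
  simp only [add_mulVec, smul_mulVec, one_mulVec, dotProduct_add, dotProduct_smul,
    smul_eq_mul, dotProduct_zero] at h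
  have hpos : 0 < x ⬝ᵥ x :=
    lt_of_le_of_ne (Finset.sum_nonneg fun i _ => mul_self_nonneg _)
      fun h => hx (dotProduct_self_eq_zero.1 h.symm)
  have h1 : 0 < (1 - t) * (x ⬝ᵥ x) := mul_pos (sub_pos.2 (lt_of_le_of_ne ht.2 ht1)) hpos
  have h2 : 0 ≤ t * (x ⬝ᵥ (M *ᵥ x)) := mul_nonneg ht.1 (hM x)
  linarith

lemma Matrix.det_add_vecMulVec_of_mulVec_eq_smul {m : Type*} [Fintype m] [DecidableEq m]
    {M : Matrix m m ℝ} {x : ℝ} (hx : x ≠ 0) {v : m → ℝ} (hv : M *ᵥ v = x • v) (l : m → ℝ) :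
    x * (M + vecMulVec v l).det = (x + l ⬝ᵥ v) * M.det := by
  have h : M + vecMulVec v l =
      M * (1 + replicateCol Unit (x⁻¹ • v) * replicateRow Unit l) := by
    rw [← vecMulVec_eq, mul_add, mul_one, mul_vecMulVec, mulVec_smul, hv, smul_smul,
      inv_mul_cancel₀ hx, one_smul]
  rw [h, det_mul, det_one_add_replicateCol_mul_replicateRow, dotProduct_smul, smul_eq_mul]
  field_simp

lemma Matrix.charpoly_coeff_one_mul_dotProduct {m : Type*} [Fintype m] [DecidableEq m]
    {F : Matrix m m ℝ} {v : m → ℝ} (hv0 : v ≠ 0) (hv : F *ᵥ v = 0) (l : m → ℝ) :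
    F.charpoly.coeff 1 * (l ⬝ᵥ v) = (-F + vecMulVec v l).det := by
  have hdet : F.det = 0 := exists_mulVec_eq_zero_iff.1 ⟨v, hv0, hv⟩
  have hdet' : (-F).det = 0 := by rw [det_neg, hdet, mul_zero]
  have key : Polynomial.X * (F - vecMulVec v l).charpoly =
      (Polynomial.X + Polynomial.C (l ⬝ᵥ v)) * F.charpoly := by
    refine Polynomial.funext fun x => ?_
    simp only [Polynomial.eval_mul, Polynomial.eval_add, Polynomial.eval_X, Polynomial.eval_C,
      eval_charpoly]
    rcases eq_or_ne x 0 with rfl | hx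
    · simp [hdet']
    · rw [← sub_add]
      refine det_add_vecMulVec_of_mulVec_eq_smul hx ?_ l
      rw [sub_mulVec, hv, sub_zero]
      ext i
      simp [scalar_apply, mulVec_diagonal]
  have h := congrArg (fun p => Polynomial.coeff p 1) key
  have h0 : ∀ M : Matrix m m ℝ, M.charpoly.coeff 0 = (-M).det := fun M => by
    rw [Polynomial.coeff_zero_eq_eval_zero, eval_charpoly]
    simp
  simp only [add_mul, Polynomial.coeff_add, Polynomial.coeff_C_mul] at h
  rw [← zero_add 1, Polynomial.coeff_X_mul, Polynomial.coeff_X_mul, h0, h0, hdet', neg_sub,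
    zero_add] at h
  rw [mul_comm, ← h]
  congr 1
  abel

lemma minkGram_mulVec_dotProduct (n : ℕ) (u v : Fin (n + 2) → ℝ) :
    (minkGram n *ᵥ u) ⬝ᵥ v = mink n u v := by
  rw [dotProduct_comm, ← mink_eq_dotProduct, mink_comm]

/-- The rank-one perturbation of `-F` by a vector `v` and its Minkowski dual. -/
noncomputable def kerPerturb (n : ℕ) (F : Matrix (Fin (n + 2)) (Fin (n + 2)) ℝ)
    (v : Fin (n + 2) → ℝ) : Matrix (Fin (n + 2)) (Fin (n + 2)) ℝ :=
  -F + vecMulVec v (minkGram n *ᵥ v)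

lemma kerPerturb_mulVec (n : ℕ) (F : Matrix (Fin (n + 2)) (Fin (n + 2)) ℝ)
    (v x : Fin (n + 2) → ℝ) : kerPerturb n F v *ᵥ x = -(F *ᵥ x) + mink n v x • v := by
  rw [kerPerturb, add_mulVec, neg_mulVec, vecMulVec_mulVec, minkGram_mulVec_dotProduct]
  simp

lemma coeff_one_mul_mink {n : ℕ} {F : Matrix (Fin (n + 2)) (Fin (n + 2)) ℝ}
    {v : Fin (n + 2) → ℝ} (hv0 : v ≠ 0) (hv : F *ᵥ v = 0) :
    F.charpoly.coeff 1 * mink n v v = (kerPerturb n F v).det := by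
  rw [← minkGram_mulVec_dotProduct, charpoly_coeff_one_mul_dotProduct hv0 hv, kerPerturb]

lemma EtaSkew.det_kerPerturb_nonpos {n : ℕ} {F : Matrix (Fin (n + 2)) (Fin (n + 2)) ℝ}
    (hF : EtaSkew n F) (v : Fin (n + 2) → ℝ) : (kerPerturb n F v).det ≤ 0 := by
  have h := det_nonneg_of_dotProduct_mulVec_nonneg (minkGram n * kerPerturb n F v) fun x => by
    have h1 : mink n x (-(F *ᵥ x) + mink n v x • v) =
        -mink n x (F *ᵥ x) + mink n v x * mink n x v := by
      simp [mink_eq_dotProduct, mulVec_add, mulVec_neg, mulVec_smul]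
    rw [← mink_mulVec_right, kerPerturb_mulVec, h1, hF.mink_self, mink_comm n x v]
    nlinarith [mul_self_nonneg (mink n v x)]
  rw [det_mul, det_minkGram] at h
  linarith

/-- If `F v = 0` with `v` non-null, the kernel of `kerPerturb n F v` is the part of the kernel
of `F` orthogonal to `v`. -/
lemma EtaSkew.of_kerPerturb_mulVec_eq_zero {n : ℕ}
    {F : Matrix (Fin (n + 2)) (Fin (n + 2)) ℝ} (hF : EtaSkew n F) {v x : Fin (n + 2) → ℝ}
    (hv : F *ᵥ v = 0) (hvv : mink n v v ≠ 0) (hx : kerPerturb n F v *ᵥ x = 0) :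
    F *ᵥ x = 0 ∧ mink n v x = 0 := by
  rw [kerPerturb_mulVec, neg_add_eq_zero] at hx
  have h := hF.mink_mulVec_of_mulVec_eq_zero hv x
  have h1 : mink n v (mink n v x • v) = mink n v x * mink n v v := by
    simp [mink_eq_dotProduct, mulVec_smul]
  rw [hx, h1] at h
  have h2 := (mul_eq_zero.1 h).resolve_right hvv
  exact ⟨by rw [hx, h2, zero_smul], h2⟩

lemma mink_nonneg_of_orthogonal_timelike {n : ℕ} {v x : Fin (n + 2) → ℝ}
    (hv : mink n v v < 0) (hvx : mink n v x = 0) : 0 ≤ mink n x x := by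
  by_contra! hx
  have hcs := Finset.sum_mul_sq_le_sq_mul_sq Finset.univ (fun k : Fin (n + 1) => v k.succ)
    (fun k => x k.succ)
  simp only [mink, ← sq] at hv hvx hx
  have hX : 0 ≤ ∑ k : Fin (n + 1), x k.succ ^ 2 := Finset.sum_nonneg fun _ _ => sq_nonneg _
  have hV : 0 ≤ ∑ k : Fin (n + 1), v k.succ ^ 2 := Finset.sum_nonneg fun _ _ => sq_nonneg _
  have h : ∑ k : Fin (n + 1), v k.succ * x k.succ = v 0 * x 0 := by linarith
  rw [h, mul_pow] at hcs
  nlinarith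

/-- The vanishing of the degree-one coefficient forces a kernel vector that is not timelike. -/
lemma EtaSkew.exists_mulVec_eq_zero_mink_nonneg {n : ℕ} (hodd : Odd n)
    {F : Matrix (Fin (n + 2)) (Fin (n + 2)) ℝ} (hF : EtaSkew n F)
    (hc : F.charpoly.coeff 1 = 0) : ∃ v ≠ 0, F *ᵥ v = 0 ∧ 0 ≤ mink n v v := by
  obtain ⟨v, hv0, hv⟩ := exists_mulVec_eq_zero_iff.2 (hF.det_eq_zero hodd)
  rcases le_or_gt 0 (mink n v v) with h | h
  · exact ⟨v, hv0, hv, h⟩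
  · have hdet := coeff_one_mul_mink hv0 hv
    rw [hc, zero_mul] at hdet
    obtain ⟨x, hx0, hx⟩ := exists_mulVec_eq_zero_iff.2 hdet.symm
    obtain ⟨h1, h2⟩ := hF.of_kerPerturb_mulVec_eq_zero hv h.ne hx
    exact ⟨x, hx0, h1, mink_nonneg_of_orthogonal_timelike h h2⟩

/-- In odd dimension there is an antisymmetric matrix whose kernel is a line. -/
lemma exists_transpose_eq_neg_ker_eq_line {n : ℕ} (hodd : Odd n) :
    ∃ B : Matrix (Fin (n + 2)) (Fin (n + 2)) ℝ, Bᵀ = -B ∧ ∃ e : Fin (n + 2) → ℝ, e ≠ 0 ∧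
      B *ᵥ e = 0 ∧ ∀ x, B *ᵥ x = 0 → ∃ a : ℝ, x = a • e := by
  obtain ⟨k, rfl⟩ := hodd
  let mid : Fin (2 * k + 1 + 2) := ⟨k + 1, by omega⟩
  let B : Matrix (Fin (2 * k + 1 + 2)) (Fin (2 * k + 1 + 2)) ℝ :=
    of fun i j => if j = i.rev then (if i < j then 1 else if j < i then -1 else 0) else 0
  have hB : ∀ x i, (B *ᵥ x) i =
      (if i < i.rev then 1 else if i.rev < i then -1 else 0) * x i.rev := fun x i => by
    simp [B, mulVec, dotProduct]
  have hmid : ∀ i : Fin (2 * k + 1 + 2), i ≠ mid → i.rev ≠ i := fun i hi h => hi <| by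
    rw [Fin.ext_iff, Fin.val_rev] at h
    rw [Fin.ext_iff]
    simp only [mid]
    omega
  have hmid' : mid.rev = mid := by
    rw [Fin.ext_iff, Fin.val_rev]
    simp only [mid]
    omega
  refine ⟨B, ?_, Pi.single mid 1, by simp, ?_, fun x hx => ⟨x mid, ?_⟩⟩
  · ext i j
    have hij : i = j.rev ↔ j = i.rev := by
      rw [Fin.ext_iff, Fin.ext_iff, Fin.val_rev, Fin.val_rev]
      omega
    rw [transpose_apply, Matrix.neg_apply]
    simp only [B, of_apply, hij]
    split_ifs <;> first | simp | (exfalso; order)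
  · ext i
    rw [hB]
    by_cases hi : i = mid
    · rw [hi, hmid']
      simp
    · have : i.rev ≠ mid := fun h => hi (by rw [← Fin.rev_rev i, h, hmid'])
      simp [this]
  · ext i
    by_cases hi : i = mid
    · simp [hi]
    · have h := hB x i.rev
      rw [hx, Fin.rev_rev] at h
      have h1 := hmid i hi
      rcases lt_or_gt_of_ne h1 with h2 | h2
      · simp [h2] at h
        simp [hi, ← h]
      · simp [h2, h2.not_gt] at h
        simp [hi, h]

lemma exists_etaSkew_ker_eq_line {n : ℕ} (hodd : Odd n) {v : Fin (n + 2) → ℝ} (hv : v ≠ 0) :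
    ∃ G, EtaSkew n G ∧ G *ᵥ v = 0 ∧ ∀ x, G *ᵥ x = 0 → ∃ a : ℝ, x = a • v := by
  obtain ⟨B, hB, e, he0, hBe, hker⟩ := exists_transpose_eq_neg_ker_eq_line hodd
  obtain ⟨A, hA⟩ := SeparatingDual.exists_continuousLinearEquiv_apply_eq (R := ℝ) hv he0
  let P := LinearMap.toMatrix' (A : (Fin (n + 2) → ℝ) →ₗ[ℝ] (Fin (n + 2) → ℝ))
  have hP : ∀ x, P *ᵥ x = A x := fun x => LinearMap.toMatrix'_mulVec _ x
  have hPdet : IsUnit Pᵀ.det := by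
    rw [det_transpose, isUnit_iff_ne_zero]
    intro h
    obtain ⟨x, hx0, hx⟩ := exists_mulVec_eq_zero_iff.2 h
    rw [hP] at hx
    exact hx0 (by simpa using hx)
  refine ⟨minkGram n * (Pᵀ * (B * P)), ?_, ?_, fun x hx => ?_⟩
  · rw [etaSkew_iff, ← mul_assoc (minkGram n) (minkGram n), minkGram_mul_self, one_mul,
      transpose_mul, minkGram_transpose, mul_assoc, minkGram_mul_self, mul_one]
    simp [transpose_mul, hB, mul_assoc]
  · simp only [← mulVec_mulVec, hP, hA, hBe, mulVec_zero]
  · have h1 : (Pᵀ * (B * P)) *ᵥ x = 0 := by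
      have := congrArg (fun y => minkGram n *ᵥ y) hx
      simpa [mulVec_mulVec, ← mul_assoc, minkGram_mul_self] using this
    have h2 : B *ᵥ (P *ᵥ x) = 0 := by
      have := congrArg (fun y => Pᵀ⁻¹ *ᵥ y) h1
      simpa only [mulVec_mulVec, ← mul_assoc, nonsing_inv_mul _ hPdet, one_mul,
        mulVec_zero] using this
    obtain ⟨a, ha⟩ := hker _ h2
    refine ⟨a, A.injective ?_⟩
    rw [← hP, ha, map_smul, hA]

open Filter Topology in
/-- A skew endomorphism with a spacelike kernel vector is a limit of skew endomorphisms whose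
degree-one coefficient is negative. -/
lemma EtaSkew.mem_closure_of_spacelike {n : ℕ} (hodd : Odd n)
    {F : Matrix (Fin (n + 2)) (Fin (n + 2)) ℝ} (hF : EtaSkew n F) {v : Fin (n + 2) → ℝ}
    (hv : F *ᵥ v = 0) (hvv : 0 < mink n v v) :
    F ∈ closure {F' | EtaSkew n F' ∧ F'.charpoly.coeff 1 < 0} := by
  have hv0 : v ≠ 0 := by
    rintro rfl
    simp [mink] at hvv
  obtain ⟨G, hG, hGv, hker⟩ := exists_etaSkew_ker_eq_line hodd hv0
  have hGdet : (kerPerturb n G v).det ≠ 0 := fun h => by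
    obtain ⟨x, hx0, hx⟩ := exists_mulVec_eq_zero_iff.2 h
    obtain ⟨h1, h2⟩ := hG.of_kerPerturb_mulVec_eq_zero hGv hvv.ne' hx
    obtain ⟨a, rfl⟩ := hker x h1
    have h3 : a * mink n v v = 0 := by
      simpa [mink_eq_dotProduct, mulVec_smul] using h2
    rcases mul_eq_zero.1 h3 with h4 | h4
    · exact hx0 (by rw [h4, zero_smul])
    · exact hvv.ne' h4
  let H : ℝ → Matrix (Fin (n + 2)) (Fin (n + 2)) ℝ := fun t => F + t • (G + (-1 : ℝ) • F)
  have hH : ∀ t, EtaSkew n (H t) := fun t => hF.add ((hG.add (hF.smul _)).smul t)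
  have hHv : ∀ t, H t *ᵥ v = 0 := fun t => by simp only [H, add_mulVec, smul_mulVec, hv, hGv, smul_zero, add_zero]
  let p : Polynomial ℝ := det ((kerPerturb n F v).map Polynomial.C +
    (Polynomial.X : Polynomial ℝ) • (F - G).map Polynomial.C)
  have hp : ∀ t, p.eval t = (kerPerturb n (H t) v).det := fun t => by
    rw [← Polynomial.coe_evalRingHom, RingHom.map_det]
    congr 1
    ext i j
    simp [kerPerturb, H, vecMulVec_apply]
    ring
  have hp0 : p ≠ 0 := by
    intro h
    apply hGdet
    have h1 := hp 1
    rw [h, Polynomial.eval_zero] at h1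
    simpa [H] using h1.symm
  have hev : ∀ᶠ t in 𝓝[≠] (0 : ℝ), p.eval t ≠ 0 := by
    have hfin : ({t | p.IsRoot t} : Set ℝ).Finite := Polynomial.finite_setOfPred_isRoot hp0
    have := (hfin.subset (Set.sdiff_subset (t := {0}))).isClosed.isOpen_compl.mem_nhds
      (show (0 : ℝ) ∈ ({t | p.IsRoot t} \ {0})ᶜ by simp)
    filter_upwards [nhdsWithin_le_nhds this, self_mem_nhdsWithin] with t ht ht0 h
    exact ht ⟨h, ht0⟩
  have hlim : Tendsto H (𝓝[≠] 0) (𝓝 F) := by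
    have hc : Continuous H := by fun_prop
    have := hc.tendsto 0
    simp only [H, zero_smul, add_zero] at this
    exact this.mono_left nhdsWithin_le_nhds
  refine mem_closure_of_tendsto hlim (hev.mono fun t ht => ⟨hH t, ?_⟩)
  have h1 := coeff_one_mul_mink hv0 (hHv t)
  have h2 := lt_of_le_of_ne ((hH t).det_kerPerturb_nonpos v) (hp t ▸ ht)
  rw [← h1] at h2
  exact neg_of_mul_neg_left h2 hvv.le

open Filter Topology in
/-- A skew endomorphism with a nonzero non-timelike kernel vector is a limit of skew
endomorphisms with a spacelike kernel vector. -/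
lemma EtaSkew.mem_closure_of_nontimelike {n : ℕ}
    {F : Matrix (Fin (n + 2)) (Fin (n + 2)) ℝ} (hF : EtaSkew n F) {v : Fin (n + 2) → ℝ}
    (hv0 : v ≠ 0) (hv : F *ᵥ v = 0) (hvv : 0 ≤ mink n v v) :
    F ∈ closure {F' | EtaSkew n F' ∧ ∃ u, F' *ᵥ u = 0 ∧ 0 < mink n u u} := by
  let D : ℝ → Matrix (Fin (n + 2)) (Fin (n + 2)) ℝ := fun t =>
    diagonal (Fin.cons (1 + t) fun _ => 1)
  have hD : ∀ t u w, mink n (D t *ᵥ u) w = mink n u (D t *ᵥ w) := fun t u w => by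
    simp [mink, D, mulVec_diagonal]
    ring
  have hDc : Continuous D := by
    refine Continuous.matrix_diagonal (continuous_pi fun i => ?_)
    refine Fin.cases ?_ (fun j => ?_) i
    · simp only [Fin.cons_zero]
      fun_prop
    · simp only [Fin.cons_succ]
      fun_prop
  have hD0 : D 0 = 1 := by
    rw [← diagonal_one]
    simp only [D]
    congr 1
    funext i
    refine Fin.cases ?_ (fun j => ?_) i <;> simp
  have hlim : Tendsto (fun t => D t * F * D t) (𝓝[>] 0) (𝓝 F) := by
    have hc : Continuous fun t => D t * F * D t := by fun_prop
    have := hc.tendsto 0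
    simp only [hD0, one_mul, mul_one] at this
    exact this.mono_left nhdsWithin_le_nhds
  refine mem_closure_of_tendsto hlim ?_
  filter_upwards [self_mem_nhdsWithin] with t ht
  have ht : 0 < t := ht
  refine ⟨fun u w => ?_, Fin.cons (v 0 / (1 + t)) fun k => v k.succ, ?_, ?_⟩
  · simp only [← mulVec_mulVec, hD]
    rw [← hD t u]
    exact hF _ _
  · have : D t *ᵥ (Fin.cons (v 0 / (1 + t)) fun k => v k.succ : Fin (n + 2) → ℝ) = v := by
      funext i
      refine Fin.cases ?_ (fun j => ?_) i
      · simp [D, mulVec_diagonal]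
        field_simp
      · simp [D, mulVec_diagonal]
    rw [← mulVec_mulVec, this, ← mulVec_mulVec, hv, mulVec_zero]
  · simp only [mink, Fin.cons_zero, Fin.cons_succ] at hvv ⊢
    by_cases h0 : v 0 = 0
    · have hne : ∑ k : Fin (n + 1), v k.succ * v k.succ ≠ 0 := fun h => hv0 <| by
        rw [Finset.sum_eq_zero_iff_of_nonneg fun _ _ => mul_self_nonneg _] at h
        funext i
        refine Fin.cases h0 (fun j => ?_) i
        simpa using h j (Finset.mem_univ _)
      have hnn : 0 ≤ ∑ k : Fin (n + 1), v k.succ * v k.succ :=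
        Finset.sum_nonneg fun _ _ => mul_self_nonneg _
      simpa [h0] using lt_of_le_of_ne hnn hne.symm
    · have h1 : v 0 / (1 + t) * (v 0 / (1 + t)) < v 0 * v 0 := by
        rw [div_mul_div_comm, div_lt_iff₀ (by positivity)]
        have : 0 < v 0 * v 0 := mul_self_pos.2 h0
        nlinarith [mul_pos this ht, mul_pos (mul_pos this ht) ht]
      linarith

lemma EtaSkew.mem_closure_of_coeff_one_eq_zero {n : ℕ} (hodd : Odd n)
    {F : Matrix (Fin (n + 2)) (Fin (n + 2)) ℝ} (hF : EtaSkew n F)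
    (hc : F.charpoly.coeff 1 = 0) :
    F ∈ closure {F' | EtaSkew n F' ∧ F'.charpoly.coeff 1 < 0} := by
  obtain ⟨v, hv0, hv, hvv⟩ := hF.exists_mulVec_eq_zero_mink_nonneg hodd hc
  refine closure_minimal ?_ isClosed_closure (hF.mem_closure_of_nontimelike hv0 hv hvv)
  rintro F' ⟨hF', u, hu, huu⟩
  exact hF'.mem_closure_of_spacelike hodd hu huu

lemma Matrix.continuous_charpoly_coeff {m : Type*} [Fintype m] [DecidableEq m] (i : ℕ) :
    Continuous fun M : Matrix m m ℝ => M.charpoly.coeff i := by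
  have h : (fun M : Matrix m m ℝ => M.charpoly.coeff i) = fun M : Matrix m m ℝ =>
      MvPolynomial.eval (fun q : m × m => M q.1 q.2) ((charpoly.univ ℝ m).coeff i) := by
    funext M
    exact (charpoly.univ_coeff_eval₂Hom m (RingHom.id ℝ) (fun q : m × m => M q.1 q.2) i).symm
  rw [h]
  exact (MvPolynomial.continuous_eval _).comp (by fun_prop)

lemma continuous_cOdd (n : ℕ) : Continuous (cOdd n) :=
  (continuous_charpoly_coeff 1).comp continuous_subtype_val

lemma cOdd_eq_of_conjRel {n : ℕ}
    {F F' : {F : Matrix (Fin (n + 2)) (Fin (n + 2)) ℝ // EtaSkew n F}}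
    (h : conjRel n F F') : cOdd n F = cOdd n F' := by
  obtain ⟨Λ, ⟨hu, -⟩, h⟩ := h
  obtain ⟨U, rfl⟩ := (isUnit_iff_isUnit_det Λ).2 hu
  rw [cOdd, cOdd, h, charpoly_units_conj]

/-- The degree-one coefficient as a function on the orbit space. -/
noncomputable def cOddQuot (n : ℕ) : Quot (conjRel n) → ℝ :=
  Quot.lift (cOdd n) fun _ _ => cOdd_eq_of_conjRel

lemma continuous_cOddQuot (n : ℕ) : Continuous (cOddQuot n) :=
  continuous_quot_lift _ (continuous_cOdd n)

lemma image_quotMk_cOdd (n : ℕ) (p : ℝ → Prop) :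
    Quot.mk (conjRel n) '' {F | p (cOdd n F)} = {q | p (cOddQuot n q)} := by
  ext q
  constructor
  · rintro ⟨F, hF, rfl⟩
    exact hF
  · induction q using Quot.ind with
    | mk F => exact fun hF => ⟨F, hF, rfl⟩

lemma closure_cOdd_neg {n : ℕ} (hodd : Odd n) :
    {F | cOdd n F ≤ 0} ⊆ closure {F | cOdd n F < 0} := by
  intro F hF
  rcases lt_or_eq_of_le (show cOdd n F ≤ 0 from hF) with h | h
  · exact subset_closure h
  · rw [closure_subtype]
    convert F.2.mem_closure_of_coeff_one_eq_zero hodd h using 2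
    ext F'
    simp [cOdd, and_comm]

/-- for `n` odd, in the orbit space (with the quotient topology), the
closure of the image of `{c < 0}` equals the image of `{c ≤ 0}`; in particular the
images of `{c > 0}` and `{c < 0}` are disjoint open sets and no orbit with `c > 0`
is a limit of orbits with `c < 0`. -/
theorem stmt6 (n : ℕ) (hn : 1 ≤ n) (hodd : Odd n) :
    closure (Quot.mk (conjRel n) '' {F | cOdd n F < 0})
        = Quot.mk (conjRel n) '' {F | cOdd n F ≤ 0} ∧
    IsOpen (Quot.mk (conjRel n) '' {F | 0 < cOdd n F}) ∧
    IsOpen (Quot.mk (conjRel n) '' {F | cOdd n F < 0}) ∧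
    Disjoint (Quot.mk (conjRel n) '' {F | 0 < cOdd n F})
      (Quot.mk (conjRel n) '' {F | cOdd n F < 0}) ∧
    (Quot.mk (conjRel n) '' {F | 0 < cOdd n F})
        ∩ closure (Quot.mk (conjRel n) '' {F | cOdd n F < 0}) = ∅ := by
  have hcl : closure (Quot.mk (conjRel n) '' {F | cOdd n F < 0})
      = Quot.mk (conjRel n) '' {F | cOdd n F ≤ 0} := by
    apply Set.Subset.antisymm
    · rw [image_quotMk_cOdd n (· < 0), image_quotMk_cOdd n (· ≤ 0)]
      exact closure_minimal (fun q (hq : cOddQuot n q < 0) => hq.le)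
        (isClosed_le (continuous_cOddQuot n) continuous_const)
    · exact (Set.image_mono (closure_cOdd_neg hodd)).trans
        (image_closure_subset_closure_image continuous_quot_mk)
  refine ⟨hcl, ?_, ?_, ?_, ?_⟩
  · rw [image_quotMk_cOdd n (0 < ·)]
    exact isOpen_lt continuous_const (continuous_cOddQuot n)
  · rw [image_quotMk_cOdd n (· < 0)]
    exact isOpen_lt (continuous_cOddQuot n) continuous_const
  · rw [image_quotMk_cOdd n (0 < ·), image_quotMk_cOdd n (· < 0), Set.disjoint_left]
    exact fun q (h1 : 0 < _) (h2 : _ < (0 : ℝ)) => lt_asymm h1 h2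
  · rw [hcl, image_quotMk_cOdd n (0 < ·), image_quotMk_cOdd n (· ≤ 0),
      ← Set.disjoint_iff_inter_eq_empty, Set.disjoint_left]
    exact fun q (h1 : 0 < _) (h2 : _ ≤ (0 : ℝ)) => h2.not_gt h1
end

section
/- Let n ≥ 3 be odd, p = (n−1)/2, λ > 0 and b₁,…,b_p ∈ ℝ. Let F be the endomorphism of ℝ^{n+2} defined by F(e₀) = −(3/(4√λ)) e₂, F(e₁) = (5/(4√λ)) e₂, F(e₂) = −(3/(4√λ)) e₀ − (5/(4√λ)) e₁, and, for i = 1,…,p, F(e_{2i+1}) = b_i e_{2i+2} and F(e_{2i+2}) = −b_i e_{2i+1}. Then F is η-skew-symmetric, the vector v := 5e₀ + 3e₁ is a timelike vector lying in ker F, and the characteristic polynomial of −F² equals X (X − 1/λ)² ∏_{i=1}^{p} (X − b_i²)². -/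
open Polynomial

open Matrix

/-- The splitting of the coordinates of `ℝ^{2p+3}` into `e₀, e₁, e₂` and the pairs
`e_{2i+3}, e_{2i+4}`. -/
def coordEquiv (p : ℕ) : Fin 3 ⊕ Fin 2 × Fin p ≃ Fin (2 * p + 1 + 2) :=
  ((Equiv.refl (Fin 3)).sumCongr ((Equiv.prodComm (Fin 2) (Fin p)).trans finProdFinEquiv)).trans
    (finSumFinEquiv.trans (finCongr (by omega)))

lemma coordEquiv_inl (p : ℕ) (j : Fin 3) :
    coordEquiv p (Sum.inl j) = ⟨j, by omega⟩ := by
  ext; simp [coordEquiv]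

lemma coordEquiv_inr (p : ℕ) (j : Fin 2) (i : Fin p) :
    coordEquiv p (Sum.inr (j, i)) = ⟨2 * i + 3 + j, by omega⟩ := by
  ext; simp [coordEquiv]; omega

lemma coordEquiv_inl_zero (p : ℕ) : coordEquiv p (Sum.inl 0) = 0 := by
  rw [coordEquiv_inl]; rfl

lemma coordEquiv_inl_one (p : ℕ) : coordEquiv p (Sum.inl 1) = 1 := by
  rw [coordEquiv_inl]; ext; simp

lemma coordEquiv_inl_two (p : ℕ) : coordEquiv p (Sum.inl 2) = 2 := by
  rw [coordEquiv_inl]; ext; exact (Nat.mod_eq_of_lt (by omega)).symm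

lemma coordEquiv_inr_zero (p : ℕ) (i : Fin p) :
    coordEquiv p (Sum.inr (0, i)) = ⟨2 * i + 3, by omega⟩ := by
  rw [coordEquiv_inr]; ext; simp

lemma coordEquiv_inr_one (p : ℕ) (i : Fin p) :
    coordEquiv p (Sum.inr (1, i)) = ⟨2 * i + 4, by omega⟩ := by
  rw [coordEquiv_inr]; ext; simp

lemma mink_eq_sum_coordEquiv (p : ℕ) (u v : Fin (2 * p + 1 + 2) → ℝ) :
    mink (2 * p + 1) u v = -2 * (u 0 * v 0)
      + ∑ x, u (coordEquiv p x) * v (coordEquiv p x) := by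
  rw [(coordEquiv p).sum_comp (fun k => u k * v k), Fin.sum_univ_succ, mink]
  ring

/-- The block form of the endomorphism: a `3 × 3` block acting on `e₀, e₁, e₂` and `p` planar
infinitesimal rotations. -/
noncomputable def blockForm {p : ℕ} (a c : ℝ) (b : Fin p → ℝ) :
    Matrix (Fin 3 ⊕ Fin 2 × Fin p) (Fin 3 ⊕ Fin 2 × Fin p) ℝ :=
  fromBlocks !![0, 0, -a; 0, 0, -c; -a, c, 0] 0 0
    (blockDiagonal fun i => !![0, -b i; b i, 0])

lemma charpoly_neg_blockForm_mul_self {p : ℕ} (a c : ℝ) (b : Fin p → ℝ) :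
    (-(blockForm a c b * blockForm a c b)).charpoly
      = X * (X - C (c ^ 2 - a ^ 2)) ^ 2 * ∏ i : Fin p, (X - C (b i ^ 2)) ^ 2 := by
  have hplanes : -(blockDiagonal (fun i => !![0, -b i; b i, 0])
      * blockDiagonal (fun i => !![0, -b i; b i, 0]))
      = diagonal (fun x : Fin 2 × Fin p => b x.2 ^ 2) := by
    rw [← blockDiagonal_mul, ← blockDiagonal_neg,
      ← blockDiagonal_diagonal (fun i _ => b i ^ 2)]
    congr 1
    funext i
    ext j k
    fin_cases j <;> fin_cases k <;> simp [sq]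
  rw [blockForm, fromBlocks_multiply, fromBlocks_neg]
  simp only [Matrix.mul_zero, Matrix.zero_mul, add_zero, zero_add, neg_zero, hplanes,
    charpoly_fromBlocks_zero₁₂, charpoly_diagonal, Fintype.prod_prod_type, Fin.prod_univ_two]
  rw [Finset.prod_pow, ← sq (∏ i, (X - C (b i ^ 2)))]
  congr 1
  rw [charpoly, det_fin_three]
  simp
  ring

lemma submatrix_coordEquiv_eq_blockForm {p : ℕ} (a c : ℝ) (b : Fin p → ℝ)
    (F : Matrix (Fin (2 * p + 1 + 2)) (Fin (2 * p + 1 + 2)) ℝ)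
    (hF0 : F *ᵥ Pi.single 0 1 = (-a) • Pi.single 2 1)
    (hF1 : F *ᵥ Pi.single 1 1 = c • Pi.single 2 1)
    (hF2 : F *ᵥ Pi.single 2 1 = (-a) • Pi.single 0 1 - c • Pi.single 1 1)
    (hFx : ∀ i : Fin p, F *ᵥ Pi.single ⟨2 * i + 3, by omega⟩ 1
      = b i • Pi.single ⟨2 * i + 4, by omega⟩ 1)
    (hFy : ∀ i : Fin p, F *ᵥ Pi.single ⟨2 * i + 4, by omega⟩ 1
      = (-b i) • Pi.single ⟨2 * i + 3, by omega⟩ 1) :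
    F.submatrix (coordEquiv p) (coordEquiv p) = blockForm a c b := by
  simp only [← coordEquiv_inl_zero, ← coordEquiv_inl_one, ← coordEquiv_inl_two,
    ← coordEquiv_inr_zero, ← coordEquiv_inr_one] at hF0 hF1 hF2 hFx hFy
  simp only [mulVec_single_one] at hF0 hF1 hF2 hFx hFy
  ext r s
  have key : ∀ {w : Fin (2 * p + 1 + 2) → ℝ}, F.col (coordEquiv p s) = w →
      F (coordEquiv p r) (coordEquiv p s) = w (coordEquiv p r) := fun h => congrFun h _
  rw [submatrix_apply]
  rcases s with s | ⟨s, i⟩ <;> fin_cases s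
  · rw [key hF0]
    rcases r with r | ⟨r, j⟩ <;> fin_cases r <;> simp [blockForm]
  · rw [key hF1]
    rcases r with r | ⟨r, j⟩ <;> fin_cases r <;> simp [blockForm]
  · rw [key hF2]
    rcases r with r | ⟨r, j⟩ <;> fin_cases r <;> simp [blockForm]
  · rw [key (hFx i)]
    rcases r with r | ⟨r, j⟩ <;> fin_cases r <;>
      simp +contextual [blockForm, Pi.single_apply, blockDiagonal_apply]
  · rw [key (hFy i)]
    rcases r with r | ⟨r, j⟩ <;> fin_cases r <;>
      simp +contextual [blockForm, Pi.single_apply, blockDiagonal_apply]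

lemma mink_mulVec_add_mink_mulVec {p : ℕ} {a c : ℝ} {b : Fin p → ℝ}
    {F : Matrix (Fin (2 * p + 1 + 2)) (Fin (2 * p + 1 + 2)) ℝ}
    (hF : F.submatrix (coordEquiv p) (coordEquiv p) = blockForm a c b)
    (u v : Fin (2 * p + 1 + 2) → ℝ) :
    mink (2 * p + 1) (F *ᵥ u) v + mink (2 * p + 1) u (F *ᵥ v) = 0 := by
  have hmul : ∀ w x, (F *ᵥ w) (coordEquiv p x) = (blockForm a c b *ᵥ (w ∘ coordEquiv p)) x := by
    intro w x
    rw [← hF, submatrix_mulVec_equiv]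
    simp [Function.comp_assoc]
  simp only [mink_eq_sum_coordEquiv, ← coordEquiv_inl_zero, hmul]
  have hplane : ∀ (j : Fin 2) (i : Fin p) (w : Fin 2 × Fin p → ℝ),
      (blockDiagonal (fun i => !![0, -b i; b i, 0]) *ᵥ w) (j, i)
        = ![-b i * w (1, i), b i * w (0, i)] j := by
    intro j i w
    fin_cases j <;>
      simp [mulVec, dotProduct, Fintype.sum_prod_type, blockDiagonal_apply, ite_mul]
  simp only [blockForm, fromBlocks_mulVec, Fintype.sum_sum_type, Fintype.sum_prod_type,
    Fin.sum_univ_three, Fin.sum_univ_two, Sum.elim_inl, Sum.elim_inr,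
    zero_mulVec, add_zero, zero_add, hplane]
  simp [mulVec, dotProduct, Fin.sum_univ_three, Finset.sum_neg_distrib, mul_left_comm,
    mul_comm]
  ring

/-- for `n = 2p + 1` odd (`n ≥ 3`), `λ > 0`, and `F` defined by
`F(e₀) = −(3/(4√λ)) e₂`, `F(e₁) = (5/(4√λ)) e₂`,
`F(e₂) = −(3/(4√λ)) e₀ − (5/(4√λ)) e₁`, `F(e_{2i+1}) = bᵢ e_{2i+2}`,
`F(e_{2i+2}) = −bᵢ e_{2i+1}` (`i = 1,…,p`): `F` is `η`-skew-symmetric,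
`v := 5e₀ + 3e₁` is a timelike vector in `ker F`, and the characteristic polynomial of
`−F²` equals `X (X − 1/λ)² ∏ᵢ (X − bᵢ²)²`. -/
theorem stmt12 (p : ℕ) (hp : 1 ≤ p) (n : ℕ) (hn : n = 2 * p + 1)
    (lam : ℝ) (hlam : 0 < lam) (b : Fin p → ℝ)
    (F : Matrix (Fin (n + 2)) (Fin (n + 2)) ℝ)
    (hF0 : F.mulVec (Pi.single 0 1)
      = (-(3 / (4 * Real.sqrt lam))) • (Pi.single 2 1 : Fin (n + 2) → ℝ))
    (hF1 : F.mulVec (Pi.single 1 1)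
      = (5 / (4 * Real.sqrt lam)) • (Pi.single 2 1 : Fin (n + 2) → ℝ))
    (hF2 : F.mulVec (Pi.single 2 1)
      = (-(3 / (4 * Real.sqrt lam))) • (Pi.single 0 1 : Fin (n + 2) → ℝ)
        - (5 / (4 * Real.sqrt lam)) • (Pi.single 1 1 : Fin (n + 2) → ℝ))
    (hFx : ∀ i : Fin p,
      F.mulVec (Pi.single ⟨2 * (i : ℕ) + 3, by have := i.isLt; omega⟩ 1)
        = b i • (Pi.single ⟨2 * (i : ℕ) + 4, by have := i.isLt; omega⟩ 1 :
            Fin (n + 2) → ℝ))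
    (hFy : ∀ i : Fin p,
      F.mulVec (Pi.single ⟨2 * (i : ℕ) + 4, by have := i.isLt; omega⟩ 1)
        = (-(b i)) • (Pi.single ⟨2 * (i : ℕ) + 3, by have := i.isLt; omega⟩ 1 :
            Fin (n + 2) → ℝ)) :
    (∀ u v, mink n (F.mulVec u) v + mink n u (F.mulVec v) = 0) ∧
    F.mulVec ((5 : ℝ) • (Pi.single 0 1 : Fin (n + 2) → ℝ)
      + (3 : ℝ) • (Pi.single 1 1 : Fin (n + 2) → ℝ)) = 0 ∧
    mink n ((5 : ℝ) • (Pi.single 0 1 : Fin (n + 2) → ℝ)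
        + (3 : ℝ) • (Pi.single 1 1 : Fin (n + 2) → ℝ))
      ((5 : ℝ) • (Pi.single 0 1 : Fin (n + 2) → ℝ)
        + (3 : ℝ) • (Pi.single 1 1 : Fin (n + 2) → ℝ)) < 0 ∧
    (-(F * F)).charpoly
      = X * (X - C (1 / lam)) ^ 2 * ∏ i : Fin p, (X - C (b i ^ 2)) ^ 2 := by
  subst hn
  have hs : √lam ^ 2 = lam := Real.sq_sqrt hlam.le
  have hF := submatrix_coordEquiv_eq_blockForm _ _ b F hF0 hF1 hF2 hFx hFy
  refine ⟨mink_mulVec_add_mink_mulVec hF, ?_, ?_, ?_⟩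
  · rw [mulVec_add, mulVec_smul, mulVec_smul, hF0, hF1, smul_smul, smul_smul, ← add_smul]
    ring_nf
    simp
  · rw [mink_eq_sum_coordEquiv]
    simp only [← coordEquiv_inl_zero, ← coordEquiv_inl_one]
    simp [Fin.sum_univ_three, Pi.single_apply]
    norm_num
  · have hlam' : (5 / (4 * √lam)) ^ 2 - (3 / (4 * √lam)) ^ 2 = 1 / lam := by
      simp only [div_pow, mul_pow, hs]
      field_simp
      norm_num
    rw [← hlam', ← charpoly_neg_blockForm_mul_self, ← hF, submatrix_mul_equiv,
      ← charpoly_reindex (coordEquiv p).symm]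
    rfl
end
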